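/- arXiv:math/0508039 — 6 statements merged into one kernel-verified Lean document; each statement's English description precedes it below -/
import Mathlib

section
/- Let V ⊆ ℤ^d be a finite set and W : ℤ^d → ℝ with W(x) > 0 for all x ∈ V. Let D be the second-order difference operator with coefficient functions α_{i,j} (1 ≤ i ≠ j ≤ d), β_i, γ_i (1 ≤ i ≤ d), δ : ℤ^d → ℝ. Then ⟨Du, v⟩ = ⟨u, Dv⟩ holds for all functions u, v : ℤ^d → ℝ if and only if: (1) W(x) γ_i(x) = W(x−e_i) β_i(x−e_i) whenever x, x−e_i ∈ V; (2) W(x−e_i) α_{i,j}(x−e_i) = W(x−e_j) α_{j,i}(x−e_j) whenever x−e_i, x−e_j ∈ V and i ≠ j; (3) γ_j(x) = 0 for x ∈ ∂_j^− V, β_j(x) = 0 for x ∈ ∂_j^+ V, and α_{i,j}(x) = 0 for x ∈ ∂_{i,j} V (i ≠ j). -/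
open Finset

/-- The `i`-th standard basis vector of `ℤ^d`. -/
def ee (d : ℕ) (i : Fin d) : Fin d → ℤ := fun j => if j = i then 1 else 0

/-- A second order difference operator written in the form (2.3):
`(Df)(x) = Σ_{i≠j} α_{i,j}(x) f(x+e_i−e_j) + Σ_i β_i(x) f(x+e_i)
           + Σ_i γ_i(x) f(x−e_i) + δ(x) f(x)`. -/
def Dop (d : ℕ) (α : Fin d → Fin d → (Fin d → ℤ) → ℝ)
    (β γ : Fin d → (Fin d → ℤ) → ℝ) (δ : (Fin d → ℤ) → ℝ)
    (f : (Fin d → ℤ) → ℝ) (x : Fin d → ℤ) : ℝ :=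
  (∑ i, ∑ j, if i ≠ j then α i j x * f (x + ee d i - ee d j) else 0)
    + (∑ i, β i x * f (x + ee d i))
    + (∑ i, γ i x * f (x - ee d i))
    + δ x * f x

/-- Symmetry criterion for a finite-range difference operator `f ↦ ∑ c p x * f (x + s p) + δ x * f x`
whose set of nonzero shifts is closed under negation. -/
theorem sum_shift_symm_iff {G P : Type*} [AddCommGroup G] (S : Finset P) (s : P → G) (ν : P → P)
    (hνS : ∀ p ∈ S, ν p ∈ S) (hνν : ∀ p, ν (ν p) = p) (hν : ∀ p, s (ν p) = -s p)
    (hinj : Set.InjOn s S) (hne : ∀ p ∈ S, s p ≠ 0)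
    (V : Finset G) (W : G → ℝ) (hW : ∀ x ∈ V, 0 < W x) (c : P → G → ℝ) (δ : G → ℝ) :
    (∀ u v : G → ℝ, ∑ x ∈ V, (∑ p ∈ S, c p x * u (x + s p) + δ x * u x) * v x * W x
        = ∑ x ∈ V, u x * (∑ p ∈ S, c p x * v (x + s p) + δ x * v x) * W x)
      ↔ ∀ p ∈ S, ∀ x ∈ V,
        (x + s p ∈ V → W x * c p x = W (x + s p) * c (ν p) (x + s p)) ∧
        (x + s p ∉ V → c p x = 0) := by
  classical
  constructor
  · intro h p hp x hx
    have hshift (q : P) (hq : q ∈ S) (y : G) :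
        ∑ p ∈ S, c p y * (Pi.single (y + s q) 1 : G → ℝ) (y + s p)
          + δ y * (Pi.single (y + s q) 1 : G → ℝ) y = c q y := by
      have h0 : y ≠ y + s q := by simpa using hne q hq
      rw [Pi.single_eq_of_ne h0, Finset.sum_eq_single_of_mem q hq]
      · simp
      · intro r hr hrq
        rw [Pi.single_eq_of_ne, mul_zero]
        exact fun e => hrq (hinj hr hq (add_left_cancel e))
    have key := h (Pi.single (x + s p) 1) (Pi.single x 1)
    rw [Finset.sum_eq_single_of_mem x hx (fun z _ hz => by simp [Pi.single_eq_of_ne hz]),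
      hshift p hp x] at key
    refine ⟨fun hy => ?_, fun hy => ?_⟩
    · rw [Finset.sum_eq_single_of_mem _ hy (fun z _ hz => by simp [Pi.single_eq_of_ne hz])] at key
      have := hshift (ν p) (hνS p hp) (x + s p)
      rw [hν, add_neg_cancel_right] at this
      rw [this] at key
      simp only [Pi.single_eq_same] at key
      linarith
    · rw [Finset.sum_eq_zero (fun z hz => by
        have hzy : z ≠ x + s p := fun e => hy (e ▸ hz)
        simp [Pi.single_eq_of_ne hzy])] at key
      simpa [(hW x hx).ne'] using key
  · intro h u v
    have hL : ∀ x, (∑ p ∈ S, c p x * u (x + s p) + δ x * u x) * v x * W x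
        = ∑ p ∈ S, c p x * u (x + s p) * v x * W x + δ x * u x * v x * W x := fun x => by
      simp only [add_mul, Finset.sum_mul]
    have hR : ∀ x, u x * (∑ p ∈ S, c p x * v (x + s p) + δ x * v x) * W x
        = ∑ p ∈ S, c p x * v (x + s p) * u x * W x + δ x * u x * v x * W x := fun x => by
      rw [← Finset.sum_mul, ← Finset.sum_mul]; ring
    simp only [hL, hR, Finset.sum_add_distrib]
    congr 1
    rw [Finset.sum_comm, Finset.sum_comm (s := V)]
    refine Finset.sum_nbij' ν ν hνS hνS (fun p _ => hνν p) (fun p _ => hνν p) fun p hp => ?_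
    have restrict (q : P) (hq : q ∈ S) (f g : G → ℝ) :
        ∑ x ∈ V, c q x * f (x + s q) * g x * W x
          = ∑ x ∈ V with x + s q ∈ V, c q x * f (x + s q) * g x * W x := by
      refine (Finset.sum_filter_of_ne fun x hx hx0 => ?_).symm
      by_contra hy
      simp [(h q hq x hx).2 hy] at hx0
    rw [restrict p hp, restrict (ν p) (hνS p hp)]
    refine Finset.sum_nbij' (· + s p) (· + s (ν p)) ?_ ?_ ?_ ?_ ?_
    · simp +contextual [hν]
    · simp +contextual [hν]
    · simp [hν]
    · simp [hν]
    · intro x hx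
      rw [Finset.mem_filter] at hx
      have := (h p hp x hx.1).1 hx.2
      rw [hν, add_neg_cancel_right]
      linear_combination u (x + s p) * v x * this

/-- The vectors `0, e_1, …, e_d`, with `none` indexing `0`. -/
def extendedBasis (d : ℕ) (a : Option (Fin d)) : Fin d → ℤ := a.elim 0 (ee d)

theorem extendedBasis_apply (d : ℕ) (a : Option (Fin d)) (k : Fin d) :
    extendedBasis d a k = if a = some k then 1 else 0 := by
  cases a <;> simp [extendedBasis, ee, eq_comm]

theorem extendedBasis_injective (d : ℕ) : Function.Injective (extendedBasis d) := by
  intro a b h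
  ext k
  have := congrFun h k
  simp only [extendedBasis_apply] at this
  split_ifs at this <;> simp_all

theorem extendedBasis_sub_injOn (d : ℕ) :
    Set.InjOn (fun p : Option (Fin d) × Option (Fin d) => extendedBasis d p.1 - extendedBasis d p.2)
      ((univ : Finset (Option (Fin d))).offDiag : Set (Option (Fin d) × Option (Fin d))) := by
  rintro ⟨a, b⟩ hab ⟨a', b'⟩ hab' h
  simp only [Finset.coe_offDiag, Finset.coe_univ, Set.mem_offDiag, Set.mem_univ, true_and]
    at hab hab' h
  have hk (k : Fin d) := congrFun h k
  simp only [Pi.sub_apply, extendedBasis_apply] at hk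
  have hor : a = a' ∨ b = b' := by
    rcases a with _ | i
    · rcases b with _ | j
      · exact absurd rfl hab
      · right
        have := hk j
        by_contra hb
        simp only [reduceCtorEq, if_false, if_true, Ne.symm hb] at this
        split_ifs at this <;> omega
    · left
      have := hk i
      by_contra ha
      simp only [if_true, Ne.symm ha, hab.symm, if_false] at this
      split_ifs at this <;> omega
  rcases hor with rfl | rfl
  · exact Prod.ext rfl (extendedBasis_injective d (sub_right_injective h))
  · exact Prod.ext (extendedBasis_injective d (sub_left_injective h)) rfl

/-- The coefficients `α`, `β`, `γ` as one family indexed by pairs: the coefficient at `(a, b)`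
multiplies `f (x + extendedBasis d a - extendedBasis d b)`. -/
def pairCoeff {d : ℕ} (α : Fin d → Fin d → (Fin d → ℤ) → ℝ)
    (β γ : Fin d → (Fin d → ℤ) → ℝ) : Option (Fin d) × Option (Fin d) → (Fin d → ℤ) → ℝ
  | (some i, some j) => α i j
  | (some i, none) => β i
  | (none, some j) => γ j
  | (none, none) => 0

theorem Dop_eq_sum_offDiag (d : ℕ) (α : Fin d → Fin d → (Fin d → ℤ) → ℝ)
    (β γ : Fin d → (Fin d → ℤ) → ℝ) (δ : (Fin d → ℤ) → ℝ)
    (f : (Fin d → ℤ) → ℝ) (x : Fin d → ℤ) :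
    Dop d α β γ δ f x
      = ∑ p ∈ (univ : Finset (Option (Fin d))).offDiag,
          pairCoeff α β γ p x * f (x + (extendedBasis d p.1 - extendedBasis d p.2))
        + δ x * f x := by
  have hoff : (univ : Finset (Option (Fin d))).offDiag
      = (univ : Finset (Option (Fin d) × Option (Fin d))).filter (fun p => p.1 ≠ p.2) := by
    ext; simp
  rw [hoff, Finset.sum_filter, Fintype.sum_prod_type]
  simp only [Dop, Fintype.sum_option, extendedBasis, pairCoeff, Option.elim, ne_eq,
    not_true_eq_false, reduceCtorEq, not_false_eq_true, if_true, if_false, Option.some_inj,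
    Finset.sum_add_distrib, zero_sub, sub_zero, add_sub_assoc, ← sub_eq_add_neg]
  ring

/-- Proposition 2.2: `D` is self-adjoint w.r.t. `⟨f,g⟩ = Σ_{x∈V} f(x)g(x)W(x)`
iff the coefficient relations (2.9), (2.10) and the boundary conditions (2.11) hold. -/
theorem selfadjoint_iff (d : ℕ) (V : Finset (Fin d → ℤ)) (W : (Fin d → ℤ) → ℝ)
    (hW : ∀ x ∈ V, 0 < W x)
    (α : Fin d → Fin d → (Fin d → ℤ) → ℝ)
    (β γ : Fin d → (Fin d → ℤ) → ℝ) (δ : (Fin d → ℤ) → ℝ) :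
    (∀ u v : (Fin d → ℤ) → ℝ,
        ∑ x ∈ V, Dop d α β γ δ u x * v x * W x
          = ∑ x ∈ V, u x * Dop d α β γ δ v x * W x)
      ↔ ((∀ i : Fin d, ∀ x : Fin d → ℤ, x ∈ V → x - ee d i ∈ V →
            W x * γ i x = W (x - ee d i) * β i (x - ee d i))
        ∧ (∀ i j : Fin d, i ≠ j → ∀ x : Fin d → ℤ,
            x - ee d i ∈ V → x - ee d j ∈ V →
            W (x - ee d i) * α i j (x - ee d i) = W (x - ee d j) * α j i (x - ee d j))
        ∧ (∀ j : Fin d, ∀ x ∈ V, x - ee d j ∉ V → γ j x = 0)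
        ∧ (∀ j : Fin d, ∀ x ∈ V, x + ee d j ∉ V → β j x = 0)
        ∧ (∀ i j : Fin d, i ≠ j → ∀ x ∈ V, x + ee d i - ee d j ∉ V → α i j x = 0)) := by
  simp only [Dop_eq_sum_offDiag]
  rw [sum_shift_symm_iff (univ : Finset (Option (Fin d))).offDiag
    (fun p => extendedBasis d p.1 - extendedBasis d p.2) Prod.swap (by simp [eq_comm])
    Prod.swap_swap (by simp) (extendedBasis_sub_injOn d) ?_ V W hW (pairCoeff α β γ) δ]
  · simp only [Finset.mem_offDiag, Finset.mem_univ, true_and, Prod.forall, Option.forall,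
      extendedBasis, pairCoeff, Option.elim, Prod.swap, ne_eq, not_true_eq_false, reduceCtorEq,
      not_false_eq_true, true_imp_iff, false_imp_iff, Option.some_inj, sub_zero,
      ← add_sub_assoc, add_zero]
    constructor
    · rintro ⟨hγ, h⟩
      refine ⟨fun i x hx => (hγ i x hx).1, fun i j hij x hi hj => ?_,
        fun j x hx => (hγ j x hx).2, fun j x hx => ((h j).1 x hx).2,
        fun i j hij x hx => ((h i).2 j hij x hx).2⟩
      have := ((h i).2 j hij _ hi).1
      rw [sub_add_cancel] at this
      exact this hj
    · rintro ⟨h1, h2, hγ, hβ, hα⟩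
      refine ⟨fun j x hx => ⟨h1 j x hx, hγ j x hx⟩, fun i => ⟨fun x hx => ⟨fun hy => ?_, hβ i x hx⟩,
        fun j hij x hx => ⟨fun hy => ?_, hα i j hij x hx⟩⟩⟩
      · have := h1 i (x + ee d i) hy
        rw [add_sub_cancel_right] at this
        exact (this hx).symm
      · have := h2 i j hij (x + ee d i)
        rw [add_sub_cancel_right] at this
        exact this hx hy
  · simp only [Finset.mem_offDiag, Finset.mem_univ, true_and]
    exact fun p hp h => hp (extendedBasis_injective d (sub_eq_zero.1 h))
end

section
/- Let V ⊆ ℤ^d be a finite set, W : ℤ^d → ℝ with W(x) > 0 for all x ∈ V, and let α_{i,j}, β_i, γ_i : ℤ^d → ℝ satisfy: W(x) γ_i(x) = W(x−e_i) β_i(x−e_i) whenever x, x−e_i ∈ V, and W(x−e_i) α_{i,j}(x−e_i) = W(x−e_j) α_{j,i}(x−e_j) whenever x−e_i, x−e_j ∈ V, i ≠ j. Then for all 1 ≤ i ≠ j ≤ d: (a) α_{i,j}(x−e_i) β_j(x−e_j) γ_i(x) = α_{j,i}(x−e_j) β_i(x−e_i) γ_j(x) whenever x, x−e_i, x−e_j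 ∈ V; (b) β_i(x−e_i) β_j(x−e_i−e_j) γ_j(x) γ_i(x−e_j) = β_j(x−e_j) β_i(x−e_i−e_j) γ_i(x) γ_j(x−e_i) whenever x, x−e_i, x−e_j, x−e_i−e_j ∈ V. -/
open Finset

/-- Corollary 2.3 (compatibility conditions): if the coefficients `α`, `β`, `γ`
of a second order difference operator satisfy the self-adjointness relations
(2.9)-(2.10) with respect to a positive weight `W` on `V`, then the
compatibility conditions (2.12a) and (2.12b) hold. -/
theorem compatibility_conditions (d : ℕ) (V : Finset (Fin d → ℤ))
    (W : (Fin d → ℤ) → ℝ) (hW : ∀ x ∈ V, 0 < W x)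
    (α : Fin d → Fin d → (Fin d → ℤ) → ℝ) (β γ : Fin d → (Fin d → ℤ) → ℝ)
    (h1 : ∀ i : Fin d, ∀ x : Fin d → ℤ, x ∈ V → x - ee d i ∈ V →
        W x * γ i x = W (x - ee d i) * β i (x - ee d i))
    (h2 : ∀ i j : Fin d, i ≠ j → ∀ x : Fin d → ℤ,
        x - ee d i ∈ V → x - ee d j ∈ V →
        W (x - ee d i) * α i j (x - ee d i) = W (x - ee d j) * α j i (x - ee d j)) :
    (∀ i j : Fin d, i ≠ j → ∀ x : Fin d → ℤ,
        x ∈ V → x - ee d i ∈ V → x - ee d j ∈ V →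
        α i j (x - ee d i) * β j (x - ee d j) * γ i x
          = α j i (x - ee d j) * β i (x - ee d i) * γ j x)
    ∧ (∀ i j : Fin d, i ≠ j → ∀ x : Fin d → ℤ,
        x ∈ V → x - ee d i ∈ V → x - ee d j ∈ V → x - ee d i - ee d j ∈ V →
        β i (x - ee d i) * β j (x - ee d i - ee d j) * γ j x * γ i (x - ee d j)
          = β j (x - ee d j) * β i (x - ee d i - ee d j) * γ i x * γ j (x - ee d i)) := by
  refine ⟨fun i j hij x hx hi hj => ?_, fun i j _ x hx hi hj hij => ?_⟩
  · have hw := (hW x hx).ne'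
    have hγi := h1 i x hx hi
    have hγj := h1 j x hx hj
    have hα := h2 i j hij x hi hj
    apply mul_left_cancel₀ hw
    linear_combination (α i j (x - ee d i) * β j (x - ee d j)) * hγi
      - (α j i (x - ee d j) * β i (x - ee d i)) * hγj
      + (β i (x - ee d i) * β j (x - ee d j)) * hα
  · have hcomm : x - ee d j - ee d i = x - ee d i - ee d j := sub_right_comm _ _ _
    have hγi := h1 i x hx hi
    have hγj := h1 j x hx hj
    have hγi' := h1 i (x - ee d j) hj (hcomm ▸ hij)
    have hγj' := h1 j (x - ee d i) hi hij
    rw [hcomm] at hγi'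
    have hw : W x * W (x - ee d i) * W (x - ee d j) * W (x - ee d i - ee d j) ≠ 0 :=
      (mul_pos (mul_pos (mul_pos (hW _ hx) (hW _ hi)) (hW _ hj)) (hW _ hij)).ne'
    apply mul_left_cancel₀ hw
    calc
      _ = (W (x - ee d i) * β i (x - ee d i))
            * (W (x - ee d i - ee d j) * β j (x - ee d i - ee d j))
            * (W x * γ j x) * (W (x - ee d j) * γ i (x - ee d j)) := by ring
      _ = (W x * γ i x) * (W (x - ee d i) * γ j (x - ee d i))
            * (W (x - ee d j) * β j (x - ee d j))
            * (W (x - ee d i - ee d j) * β i (x - ee d i - ee d j)) := by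
          rw [← hγi, ← hγj', hγj, hγi']
      _ = _ := by ring
end

section
/- Let a, b ∈ ℝ and let A_{i,j} (1 ≤ i,j ≤ d) be polynomials of total degree at most 2 and B_i (1 ≤ i ≤ d) polynomials of total degree at most 1 in ℝ[x_1,…,x_d] such that B_i − b·x_i is constant, A_{i,i} − a·x_i² has total degree at most 1, and A_{i,j} + A_{j,i} − 2a·x_i x_j has total degree at most 1 for i ≠ j. Let D = Σ_{1≤i,j≤d} A_{i,j} Δ_i ∇_j + Σ_{i=1}^d B_i Δ_i. Then for every multi-index μ ∈ ℕ_0^d, the polynomial D(x^μ) − |μ|(a|μ| − a + b)·x^μ has total degree at most |μ| − 1. -/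
open Finset MvPolynomial

/-- Substitution `x ↦ x + c` on multivariate polynomials. -/
noncomputable def pshift (d : ℕ) (c : Fin d → ℝ) (p : MvPolynomial (Fin d) ℝ) :
    MvPolynomial (Fin d) ℝ :=
  MvPolynomial.bind₁ (fun j => MvPolynomial.X j + MvPolynomial.C (c j)) p

/-- Forward difference `Δ_i p = p(x + e_i) − p(x)` on polynomials. -/
noncomputable def fdiff (d : ℕ) (i : Fin d) (p : MvPolynomial (Fin d) ℝ) :
    MvPolynomial (Fin d) ℝ :=
  pshift d (fun j => if j = i then 1 else 0) p - p

/-- Backward difference `∇_i p = p(x) − p(x − e_i)` on polynomials. -/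
noncomputable def bdiff (d : ℕ) (i : Fin d) (p : MvPolynomial (Fin d) ℝ) :
    MvPolynomial (Fin d) ℝ :=
  p - pshift d (fun j => if j = i then -1 else 0) p

/-- Polynomials all of whose monomials have degree at most the integer `n`;
this is zero for `n < 0`. -/
noncomputable def degLE (σ : Type*) (n : ℤ) : Submodule ℝ (MvPolynomial σ ℝ) :=
  restrictSupport ℝ {m | (m.degree : ℤ) ≤ n}

section Filtration

variable {σ : Type*}

lemma degLE_mono {m n : ℤ} (h : m ≤ n) : degLE σ m ≤ degLE σ n :=
  restrictSupport_mono ℝ fun _ hm => le_trans hm h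

lemma monomial_mem_degLE (m : σ →₀ ℕ) (r : ℝ) {n : ℤ} (h : (m.degree : ℤ) ≤ n) :
    monomial m r ∈ degLE σ n :=
  (monomial_mem_restrictSupport ℝ).2 (Or.inl h)

lemma C_mem_degLE (r : ℝ) : C r ∈ degLE σ 0 :=
  monomial_mem_degLE 0 r (by simp)

lemma X_mem_degLE (i : σ) : X i ∈ degLE σ 1 :=
  monomial_mem_degLE _ 1 (by simp)

lemma mul_mem_degLE {m n k : ℤ} {p q : MvPolynomial σ ℝ} (hp : p ∈ degLE σ m)
    (hq : q ∈ degLE σ n) (h : m + n ≤ k) : p * q ∈ degLE σ k := by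
  refine restrictSupport_mono ℝ ?_
    ((restrictSupport_add (R := ℝ) _ _).symm ▸ Submodule.mul_mem_mul hp hq)
  rintro _ ⟨s, hs, t, ht, rfl⟩
  simp only [Set.mem_ofPred_eq, map_add, Nat.cast_add] at hs ht ⊢
  omega

lemma mem_degLE_of_totalDegree_le {p : MvPolynomial σ ℝ} {n : ℕ} (h : p.totalDegree ≤ n) :
    p ∈ degLE σ n := fun m hm => by
  have := (le_totalDegree hm).trans h
  exact Int.ofNat_le.2 this

lemma totalDegree_le_of_mem_degLE {p : MvPolynomial σ ℝ} {k : ℤ} {n : ℕ}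
    (h : p ∈ degLE σ k) (hk : k ≤ n) : p.totalDegree ≤ n :=
  Finset.sup_le fun m hm => by
    have : (m.degree : ℤ) ≤ k := h hm
    have h' : m.degree ≤ n := by omega
    exact h'

/-- A linear map that sends `1` to degree at most `k`, and for which the bound
"`Φ` raises the degree by at most `k`" is stable under multiplication by variables,
raises degrees by at most `k`. -/
lemma map_mem_degLE (Φ : MvPolynomial σ ℝ →ₗ[ℝ] MvPolynomial σ ℝ) (k : ℤ)
    (h1 : Φ 1 ∈ degLE σ k)
    (hX : ∀ (i : σ) (n : ℤ) (q : MvPolynomial σ ℝ), q ∈ degLE σ n → Φ q ∈ degLE σ (n + k) →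
      Φ (X i * q) ∈ degLE σ (n + 1 + k))
    {n : ℤ} {p : MvPolynomial σ ℝ} (hp : p ∈ degLE σ n) : Φ p ∈ degLE σ (n + k) := by
  classical
  have hmon : ∀ (N : ℕ) (m : σ →₀ ℕ), m.degree = N → Φ (monomial m 1) ∈ degLE σ (N + k) := by
    intro N
    induction N with
    | zero =>
      intro m hm
      obtain rfl := (Finsupp.degree_eq_zero_iff m).1 hm
      simpa using h1
    | succ N ih =>
      intro m hm
      have hne : m ≠ 0 := by rintro rfl; simp at hm
      obtain ⟨i, hi⟩ := Finsupp.ne_iff.1 hne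
      have hle : Finsupp.single i 1 ≤ m :=
        Finsupp.single_le_iff.2 (Nat.one_le_iff_ne_zero.2 hi)
      obtain ⟨m', rfl⟩ := exists_add_of_le hle
      have hm' : m'.degree = N := by
        simp only [map_add, Finsupp.degree_single] at hm
        omega
      have := hX i N (monomial m' 1) (monomial_mem_degLE _ _ (by omega)) (ih m' hm')
      rw [X, monomial_mul, one_mul] at this
      exact_mod_cast this
  rw [degLE, restrictSupport_eq_span] at hp
  induction hp using Submodule.span_induction with
  | mem x hx =>
    obtain ⟨m, hm, rfl⟩ := hx
    exact degLE_mono (by simpa using hm) (hmon _ m rfl)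
  | zero => simp
  | add x y _ _ hx hy => rw [map_add]; exact add_mem hx hy
  | smul r x _ hx => rw [map_smul]; exact Submodule.smul_mem _ r hx

lemma derivation_mem_degLE (D : Derivation ℝ (MvPolynomial σ ℝ) (MvPolynomial σ ℝ))
    (c : σ → ℝ) (hD : ∀ j, D (X j) = C (c j)) {n : ℤ} {p : MvPolynomial σ ℝ}
    (hp : p ∈ degLE σ n) : D p ∈ degLE σ (n - 1) := by
  refine map_mem_degLE (D : MvPolynomial σ ℝ →ₗ[ℝ] MvPolynomial σ ℝ) (-1) (by simp) ?_ hp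
  intro i n q hq hDq
  simp only [Derivation.coeFn_coe, Derivation.leibniz, hD, smul_eq_mul] at hDq ⊢
  exact add_mem (mul_mem_degLE (X_mem_degLE i) hDq (by omega))
    (mul_mem_degLE hq (C_mem_degLE _) (by omega))

lemma pderiv_mem_degLE (i : σ) {n : ℤ} {p : MvPolynomial σ ℝ} (hp : p ∈ degLE σ n) :
    pderiv i p ∈ degLE σ (n - 1) := by
  classical
  refine derivation_mem_degLE (pderiv i) (Pi.single i 1) (fun j => ?_) hp
  rw [pderiv_X]
  by_cases h : j = i
  · subst h; simp
  · simp [Pi.single_eq_of_ne h]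

lemma pderiv_comm (i j : σ) (p : MvPolynomial σ ℝ) :
    pderiv i (pderiv j p) = pderiv j (pderiv i p) := by
  classical
  have : ⁅pderiv (R := ℝ) i, pderiv (R := ℝ) j⁆ = 0 := by
    refine derivation_ext fun k => ?_
    rw [Derivation.commutator_apply, pderiv_X, pderiv_X]
    by_cases hi : k = i <;> by_cases hj : k = j <;> simp [Pi.single_apply, hi, hj, apply_ite]
  have h := congrArg (fun D => D p) this
  simpa [Derivation.commutator_apply, sub_eq_zero] using h

end Filtration

section Difference

variable {d : ℕ}

/-- Taylor expansion of a shift to first order. -/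
lemma pshift_sub_sub_derivation_mem_degLE (c : Fin d → ℝ)
    (D : Derivation ℝ (MvPolynomial (Fin d) ℝ) (MvPolynomial (Fin d) ℝ))
    (hD : ∀ j, D (X j) = C (c j)) {n : ℤ} {p : MvPolynomial (Fin d) ℝ}
    (hp : p ∈ degLE (Fin d) n) : pshift d c p - p - D p ∈ degLE (Fin d) (n - 2) := by
  refine map_mem_degLE ((bind₁ fun j => X j + C (c j)).toLinearMap - LinearMap.id -
    (D : MvPolynomial (Fin d) ℝ →ₗ[ℝ] MvPolynomial (Fin d) ℝ)) (-2) (by simp) ?_ hp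
  intro i n q hq hr
  have hDq := derivation_mem_degLE D c hD hq
  simp only [LinearMap.sub_apply, AlgHom.toLinearMap_apply, LinearMap.id_apply,
    Derivation.coeFn_coe, Derivation.leibniz, hD, smul_eq_mul, map_mul, bind₁_X_right] at hr ⊢
  set T := bind₁ (fun j => X j + C (c j)) q
  have : (X i + C (c i)) * T - X i * q - (X i * D q + q * C (c i)) =
      X i * (T - q - D q) + C (c i) * ((T - q - D q) + D q) := by ring
  rw [this]
  exact add_mem (mul_mem_degLE (X_mem_degLE i) hr (by omega))
    (mul_mem_degLE (C_mem_degLE _)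
      (add_mem (degLE_mono (by omega) hr) hDq) (k := n + 1 + -2) (n := n - 1) (by omega))

lemma fdiff_sub_pderiv_mem_degLE (i : Fin d) {n : ℤ} {p : MvPolynomial (Fin d) ℝ}
    (hp : p ∈ degLE (Fin d) n) : fdiff d i p - pderiv i p ∈ degLE (Fin d) (n - 2) :=
  pshift_sub_sub_derivation_mem_degLE _ (pderiv i)
    (fun j => by by_cases h : j = i <;> simp [pderiv_X, h]) hp

lemma bdiff_sub_pderiv_mem_degLE (i : Fin d) {n : ℤ} {p : MvPolynomial (Fin d) ℝ}
    (hp : p ∈ degLE (Fin d) n) : bdiff d i p - pderiv i p ∈ degLE (Fin d) (n - 2) := by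
  have h := neg_mem (pshift_sub_sub_derivation_mem_degLE (fun j => if j = i then -1 else 0)
    (-pderiv i)
    (fun j => by by_cases h : j = i <;> simp [pderiv_X, h]) hp)
  convert h using 1
  rw [bdiff, Derivation.neg_apply]
  ring

lemma fdiff_bdiff_sub_pderiv_mem_degLE (i j : Fin d) {n : ℤ} {p : MvPolynomial (Fin d) ℝ}
    (hp : p ∈ degLE (Fin d) n) :
    fdiff d i (bdiff d j p) - pderiv i (pderiv j p) ∈ degLE (Fin d) (n - 3) := by
  have hr := bdiff_sub_pderiv_mem_degLE j hp
  have hb : bdiff d j p ∈ degLE (Fin d) (n - 1) := by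
    have := add_mem (degLE_mono (by omega) hr) (pderiv_mem_degLE j hp)
    simpa using this
  have h := add_mem (degLE_mono (n := n - 3) (by omega) (fdiff_sub_pderiv_mem_degLE i hb))
    (degLE_mono (n := n - 3) (by omega) (pderiv_mem_degLE i hr))
  rw [map_sub] at h
  simpa using h

/-- Second-order Euler identity. -/
lemma MvPolynomial.IsHomogeneous.sum_X_mul_X_mul_pderiv_pderiv
    {p : MvPolynomial (Fin d) ℝ} {n : ℕ}
    (hp : p.IsHomogeneous n) :
    ∑ i, ∑ j, X i * X j * pderiv i (pderiv j p) = C ((n : ℝ) * n - n) * p := by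
  have hE := hp.sum_X_mul_pderiv
  have h : ∀ i, ∑ j, X i * X j * pderiv i (pderiv j p) = (n : MvPolynomial (Fin d) ℝ) *
      (X i * pderiv i p) - X i * pderiv i p := by
    intro i
    have := congrArg (pderiv i) hE
    simp only [map_sum, Derivation.leibniz, smul_eq_mul, pderiv_X, Finset.sum_add_distrib,
      nsmul_eq_mul, Derivation.map_natCast, add_zero, Pi.single_apply, mul_ite, mul_one, mul_zero] at this
    simp only [Finset.sum_ite_eq', Finset.mem_univ, if_true] at this
    simp only [mul_assoc, ← Finset.mul_sum]
    linear_combination X i * this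
  simp only [h, Finset.sum_sub_distrib, ← Finset.mul_sum, hE, nsmul_eq_mul, map_sub, map_mul,
    map_natCast]
  ring

end Difference

/-- In the proof of Theorem 3.7: if `B_i = b x_i mod Π^d_0`,
`A_{i,i} = a x_i² mod Π^d_1` and `A_{i,j} + A_{j,i} = 2a x_i x_j mod Π^d_1`,
then `D(x^μ) = |μ|(a|μ| − a + b) x^μ mod Π^d_{|μ|−1}` for
`D = Σ A_{i,j} Δ_i ∇_j + Σ B_i Δ_i`. -/
theorem Dop_monomial_leading_term (d : ℕ) (a b : ℝ)
    (A : Fin d → Fin d → MvPolynomial (Fin d) ℝ)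
    (B : Fin d → MvPolynomial (Fin d) ℝ)
    (hA2 : ∀ i j, (A i j).totalDegree ≤ 2)
    (hB1 : ∀ i, (B i).totalDegree ≤ 1)
    (hB : ∀ i, (B i - C b * X i).totalDegree = 0)
    (hAii : ∀ i, (A i i - C a * X i ^ 2).totalDegree ≤ 1)
    (hAij : ∀ i j, i ≠ j → (A i j + A j i - C (2 * a) * X i * X j).totalDegree ≤ 1)
    (μ : Fin d →₀ ℕ) :
    ((∑ i, ∑ j, A i j * fdiff d i (bdiff d j (monomial μ (1 : ℝ))))
        + (∑ i, B i * fdiff d i (monomial μ (1 : ℝ)))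
        - C (((∑ i, μ i : ℕ) : ℝ) * (a * ((∑ i, μ i : ℕ) : ℝ) - a + b))
            * monomial μ (1 : ℝ)).totalDegree
      ≤ (∑ i, μ i) - 1 := by
  rw [← Finsupp.degree_eq_sum]
  set n := μ.degree
  set p : MvPolynomial (Fin d) ℝ := monomial μ 1
  have hp : p ∈ degLE (Fin d) n := monomial_mem_degLE μ 1 le_rfl
  have hhom : p.IsHomogeneous n := isHomogeneous_monomial 1 rfl
  have h2 : ∀ i j, pderiv i (pderiv j p) ∈ degLE (Fin d) (n - 2) := fun i j =>
    degLE_mono (by omega) (pderiv_mem_degLE i (pderiv_mem_degLE j hp))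
  have hA : ∑ i, ∑ j, A i j * (fdiff d i (bdiff d j p) - pderiv i (pderiv j p)) ∈
      degLE (Fin d) (n - 1) :=
    sum_mem fun i _ => sum_mem fun j _ =>
      mul_mem_degLE (mem_degLE_of_totalDegree_le (hA2 i j))
        (fdiff_bdiff_sub_pderiv_mem_degLE i j hp) (by push_cast; omega)
  have hBf : ∑ i, B i * (fdiff d i p - pderiv i p) ∈ degLE (Fin d) (n - 1) :=
    sum_mem fun i _ => mul_mem_degLE (mem_degLE_of_totalDegree_le (hB1 i))
      (fdiff_sub_pderiv_mem_degLE i hp) (by push_cast; omega)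
  have hBp : ∑ i, (B i - C b * X i) * pderiv i p ∈ degLE (Fin d) (n - 1) :=
    sum_mem fun i _ => mul_mem_degLE (mem_degLE_of_totalDegree_le (hB i).le)
      (pderiv_mem_degLE i hp) (by push_cast; omega)
  have hS : ∀ i j, A i j + A j i - C (2 * a) * X i * X j ∈ degLE (Fin d) 1 := by
    intro i j
    by_cases hij : i = j
    · subst hij
      have h : A i i - C a * X i ^ 2 ∈ degLE (Fin d) 1 :=
        mem_degLE_of_totalDegree_le (hAii i)
      convert add_mem h h using 1
      rw [C_mul, show (C 2 : MvPolynomial (Fin d) ℝ) = 2 from map_ofNat C 2]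
      ring
    · exact mem_degLE_of_totalDegree_le (hAij i j hij)
  have hAs : ∑ i, ∑ j, (A i j + A j i - C (2 * a) * X i * X j) * pderiv i (pderiv j p) ∈
      degLE (Fin d) (n - 1) :=
    sum_mem fun i _ => sum_mem fun j _ => mul_mem_degLE (hS i j) (h2 i j) (by omega)
  have hswap : ∑ i, ∑ j, A j i * pderiv i (pderiv j p) =
      ∑ i, ∑ j, A i j * pderiv i (pderiv j p) := by
    rw [Finset.sum_comm]
    simp only [pderiv_comm]
  have hE1 := hhom.sum_X_mul_pderiv
  have hE2 := hhom.sum_X_mul_X_mul_pderiv_pderiv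
  have key := add_mem (add_mem (add_mem hA hBf) hBp) (Submodule.smul_mem _ (2⁻¹ : ℝ) hAs)
  refine totalDegree_le_of_mem_degLE (k := n - 1) ?_ (by omega)
  convert key using 1
  simp only [mul_sub, sub_mul, add_mul, mul_assoc, Finset.sum_sub_distrib, Finset.sum_add_distrib,
    ← Finset.mul_sum, hswap, smul_eq_C_mul, hE1, nsmul_eq_mul] at hE2 ⊢
  rw [hE2]
  have h2' : (C (2⁻¹ : ℝ) : MvPolynomial (Fin d) ℝ) * 2 = 1 := by
    rw [← map_ofNat C 2, ← C_mul]; norm_num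
  simp only [map_mul, map_sub, map_add, map_natCast, map_ofNat]
  linear_combination (C a * ((n : MvPolynomial (Fin d) ℝ) * n - n) * p -
    ∑ i, ∑ j, A i j * pderiv i (pderiv j p)) * h2'
end

section
/- Let d ≥ 2 and let a, b, q_{i,j}, l_{i,j}, s_i ∈ ℝ (1 ≤ i,j ≤ d) with q_{i,i} = a and q_{i,j} + q_{j,i} = 2a for i ≠ j. Define the polynomials A_{i,j}(x) = x_j(q_{i,j} x_i + l_{i,j}) and B_i(x) = b x_i + s_i, and set α_{i,j} = −A_{i,j} (i ≠ j), β_i = Σ_{k=1}^d A_{i,k} + B_i, γ_i = Σ_{k=1}^d A_{k,i}. If for all 1 ≤ i ≠ j ≤ d the identity α_{i,j}(x−e_i) β_j(x−e_j) γ_i(x) = α_{j,i}(x−e_j) β_i(x−e_i) γ_j(x) holds for all x ∈ ℝ^d, then q_{i,j} = a for all i, j; that is, A_{i,j}(x) = x_j(a x_i + l_{i,j}). -/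
open Finset

/-- The `i`-th standard basis vector of `ℝ^d`. -/
def er (d : ℕ) (i : Fin d) : Fin d → ℝ := fun j => if j = i then 1 else 0

/-- Two real numbers `p`, `r` with `p + r = 2a` and `p (r + a)² = r (p + a)²` satisfy `p = a`. -/
lemma eq_of_add_eq_of_mul_add_sq_eq {a p r : ℝ} (hs : p + r = 2 * a)
    (h : p * (r + a) ^ 2 = r * (p + a) ^ 2) : p = a := by
  obtain rfl : r = 2 * a - p := by linarith
  have h3 : (p - a) ^ 3 = 0 := by linear_combination h / 2
  exact sub_eq_zero.mp (pow_eq_zero_iff (by norm_num) |>.mp h3)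

/-- Comparison of the leading coefficients of the two sides of the compatibility condition
along the ray spanned by `e_i + e_j`. -/
lemma leading_coeff_eq {a b p r l₁ l₂ m₁ m₂ s₁ s₂ L₁ L₂ : ℝ}
    (h : ∀ t : ℝ,
      -(t * (p * (t - 1) + l₁)) *
          (t * (r * (t - 1) + l₂) + (t - 1) * (a * (t - 1) + m₂) + (b * (t - 1) + s₂)) *
          (t * (a * t + r * t + L₁)) =
        -(t * (r * (t - 1) + l₂)) *
          (t * (p * (t - 1) + l₁) + (t - 1) * (a * (t - 1) + m₁) + (b * (t - 1) + s₁)) *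
          (t * (a * t + p * t + L₂))) :
    p * (r + a) ^ 2 = r * (p + a) ^ 2 := by
  -- both sides are polynomials of degree at most six in `t`
  linear_combination
    -(h 0 - 6 * h 1 + 15 * h 2 - 20 * h 3 + 15 * h 4 - 6 * h 5 + h 6) / 720

/-- Proposition 3.9 (key step): with `A_{i,j}(x) = x_j(q_{i,j} x_i + l_{i,j})`,
`B_i(x) = b x_i + s_i`, `q_{i,i} = a`, `q_{i,j} + q_{j,i} = 2a`, the first
compatibility condition (2.12a) for the associated coefficients
`α_{i,j} = −A_{i,j}`, `β_i = Σ_k A_{i,k} + B_i`, `γ_i = Σ_k A_{k,i}`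
forces `q_{i,j} = a` for all `i, j`. -/
theorem q_eq_a (d : ℕ) (hd : 2 ≤ d) (a b : ℝ)
    (q l : Fin d → Fin d → ℝ) (s : Fin d → ℝ)
    (hqd : ∀ i, q i i = a)
    (hqs : ∀ i j, i ≠ j → q i j + q j i = 2 * a)
    (A : Fin d → Fin d → (Fin d → ℝ) → ℝ)
    (hA : ∀ i j, ∀ x : Fin d → ℝ, A i j x = x j * (q i j * x i + l i j))
    (B : Fin d → (Fin d → ℝ) → ℝ)
    (hB : ∀ i, ∀ x : Fin d → ℝ, B i x = b * x i + s i)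
    (α : Fin d → Fin d → (Fin d → ℝ) → ℝ)
    (hα : ∀ i j, i ≠ j → ∀ x : Fin d → ℝ, α i j x = -(A i j x))
    (β : Fin d → (Fin d → ℝ) → ℝ)
    (hβ : ∀ i, ∀ x : Fin d → ℝ, β i x = (∑ k, A i k x) + B i x)
    (γ : Fin d → (Fin d → ℝ) → ℝ)
    (hγ : ∀ i, ∀ x : Fin d → ℝ, γ i x = ∑ k, A k i x)
    (hcomp : ∀ i j : Fin d, i ≠ j → ∀ x : Fin d → ℝ,
        α i j (x - er d i) * β j (x - er d j) * γ i x
          = α j i (x - er d j) * β i (x - er d i) * γ j x) :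
    ∀ i j : Fin d, q i j = a := by
  intro i j
  obtain rfl | hij := eq_or_ne i j
  · exact hqd i
  have sum_pair : ∀ (f : Fin d → ℝ) (i j : Fin d), i ≠ j →
      (∀ k, k ≠ i → k ≠ j → f k = 0) → ∑ k, f k = f i + f j :=
    fun f i j hij hf => Fintype.sum_eq_add i j hij fun k hk => hf k hk.1 hk.2
  have hβ' : ∀ (t : ℝ) (x : Fin d → ℝ) (i j : Fin d), i ≠ j → x i = t → x j = t →
      (∀ k, k ≠ i → k ≠ j → x k = 0) →
      β j (x - er d j) = t * (q j i * (t - 1) + l j i) +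
        (t - 1) * (a * (t - 1) + l j j) + (b * (t - 1) + s j) := by
    intro t x i j hij hi hj hx
    rw [hβ, hB, sum_pair _ i j hij]
    · simp [hA, er, hij, hi, hj, hqd]
    · intro k hki hkj
      simp [hA, er, hkj, hx k hki hkj]
  have hγ' : ∀ (t : ℝ) (x : Fin d → ℝ) (i j : Fin d), i ≠ j → x i = t → x j = t →
      (∀ k, k ≠ i → k ≠ j → x k = 0) →
      γ i x = t * (a * t + q j i * t + ∑ k, l k i) := by
    intro t x i j hij hi hj hx
    simp only [hγ, hA]
    rw [← Finset.mul_sum, Finset.sum_add_distrib, sum_pair (fun k => q k i * x k) i j hij]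
    · simp only [hi, hj, hqd]
    · intro k hki hkj
      simp [hx k hki hkj]
  refine eq_of_add_eq_of_mul_add_sq_eq (hqs i j hij)
    (leading_coeff_eq (b := b) (l₁ := l i j) (l₂ := l j i) (m₁ := l i i) (m₂ := l j j)
      (s₁ := s i) (s₂ := s j) (L₁ := ∑ k, l k i) (L₂ := ∑ k, l k j) fun t => ?_)
  let x : Fin d → ℝ := fun k => if k = i ∨ k = j then t else 0
  have hi : x i = t := by simp [x]
  have hj : x j = t := by simp [x]
  have hx : ∀ k, k ≠ i → k ≠ j → x k = 0 := fun k hki hkj => by simp [x, hki, hkj]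
  have hx' : ∀ k, k ≠ j → k ≠ i → x k = 0 := fun k hkj hki => hx k hki hkj
  have key := hcomp i j hij x
  rw [hα i j hij, hα j i hij.symm, hA, hA, hβ' t x i j hij hi hj hx,
    hβ' t x j i hij.symm hj hi hx', hγ' t x i j hij hi hj hx,
    hγ' t x j i hij.symm hj hi hx'] at key
  simpa [er, hij, hij.symm, hi, hj] using key
end

section
/- Let α_1, α_2, α_3 ∈ ℝ with α_1 and α_2 not equal to any negative integer, and for n ∈ ℕ_0 define the polynomial R_n(x) = Σ_{k=0}^n [(−n)_k (n − α_3 + α_1 + α_2 + 1)_k / ((α_1+1)_k (α_2+1)_k)] · (−x)_k / k!. Let D be the operator (Df)(x) = −x(x+α_3)(f(x+1) − 2f(x) + f(x−1)) + ((α_3 − α_1 − α_2 − 2)x − (1+α_1)(1+α_2))(f(x+1) − f(x)). Then D(R_n)(x) = n(α_3 − α_1 − α_2 − 1 − n) R_n(x) for all x ∈ ℝ and all n ∈ ℕ_0. -/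
open Finset

/-- Pochhammer symbol `(a)_k = a(a+1)⋯(a+k−1)`. -/
noncomputable def poch (a : ℝ) (k : ℕ) : ℝ := ∏ i ∈ Finset.range k, (a + i)

/-- The polynomials `R_n` of (4.10):
`R_n(x) = Σ_k (−n)_k (n−α₃+α₁+α₂+1)_k / ((α₁+1)_k (α₂+1)_k) · (−x)_k / k!`. -/
noncomputable def Rpol (α₁ α₂ α₃ : ℝ) (n : ℕ) (x : ℝ) : ℝ :=
  ∑ k ∈ Finset.range (n + 1),
    poch (-(n : ℝ)) k * poch ((n : ℝ) - α₃ + α₁ + α₂ + 1) k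
      / (poch (α₁ + 1) k * poch (α₂ + 1) k) * poch (-x) k / (Nat.factorial k : ℝ)

theorem poch_succ (a : ℝ) (k : ℕ) : poch a (k + 1) = poch a k * (a + k) :=
  Finset.prod_range_succ _ _

theorem poch_succ_left (a : ℝ) (k : ℕ) : poch a (k + 1) = a * poch (a + 1) k := by
  simp only [poch, Finset.prod_range_succ', Nat.cast_zero, add_zero, mul_comm a]
  congr 1
  exact Finset.prod_congr rfl fun i _ => by push_cast; ring

theorem poch_ne_zero {a : ℝ} (h : ∀ m : ℕ, a + m ≠ 0) (k : ℕ) : poch a k ≠ 0 :=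
  Finset.prod_ne_zero_iff.2 fun i _ => h i

/-- The action of the difference operator `D` on `x ↦ (−x)_{k+1}`. -/
theorem difference_operator_poch (α₁ α₂ α₃ x : ℝ) (k : ℕ) :
    -x * (x + α₃) * (poch (-(x + 1)) (k + 1) - 2 * poch (-x) (k + 1)
        + poch (-(x - 1)) (k + 1))
      + ((α₃ - α₁ - α₂ - 2) * x - (1 + α₁) * (1 + α₂))
          * (poch (-(x + 1)) (k + 1) - poch (-x) (k + 1))
      = (k + 1) * (α₃ - α₁ - α₂ - 1 - (k + 1)) * poch (-x) (k + 1)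
        + (k + 1) * (α₁ + 1 + k) * (α₂ + 1 + k) * poch (-x) k := by
  have hfwd : poch (-(x + 1)) (k + 1) = (-x - 1) * poch (-x) k := by
    rw [poch_succ_left, show -(x + 1) + 1 = -x by ring]
    ring
  have hbwd : -x * poch (-(x - 1)) (k + 1) = poch (-x) k * (-x + k) * (1 - x + k) := by
    have h := poch_succ_left (-x) k
    rw [poch_succ] at h
    rw [show -(x - 1) = -x + 1 by ring, poch_succ]
    linear_combination (x - 1 - k) * h
  rw [hfwd, poch_succ (-x) k]
  linear_combination (x + α₃) * hbwd

/-- The coefficient of `(−x)_k` in `R_n(x)`. -/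
noncomputable def Rcoeff (α₁ α₂ α₃ : ℝ) (n k : ℕ) : ℝ :=
  poch (-(n : ℝ)) k * poch ((n : ℝ) - α₃ + α₁ + α₂ + 1) k
    / (poch (α₁ + 1) k * poch (α₂ + 1) k) / (Nat.factorial k : ℝ)

theorem Rpol_eq_sum_Rcoeff (α₁ α₂ α₃ : ℝ) (n : ℕ) (x : ℝ) :
    Rpol α₁ α₂ α₃ n x = ∑ k ∈ Finset.range (n + 1), Rcoeff α₁ α₂ α₃ n k * poch (-x) k :=
  Finset.sum_congr rfl fun k _ => by rw [Rcoeff]; ring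

theorem Rcoeff_succ {α₁ α₂ : ℝ} (h₁ : ∀ m : ℕ, α₁ + 1 + m ≠ 0) (h₂ : ∀ m : ℕ, α₂ + 1 + m ≠ 0)
    (α₃ : ℝ) (n k : ℕ) :
    Rcoeff α₁ α₂ α₃ n (k + 1) * ((k + 1) * (α₁ + 1 + k) * (α₂ + 1 + k))
      = (n * (α₃ - α₁ - α₂ - 1 - n) - k * (α₃ - α₁ - α₂ - 1 - k)) * Rcoeff α₁ α₂ α₃ n k := by
  have hp₁ := poch_ne_zero h₁ k
  have hp₂ := poch_ne_zero h₂ k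
  have hk₁ := h₁ k
  have hk₂ := h₂ k
  have hf : (Nat.factorial k : ℝ) ≠ 0 := by positivity
  have hk : (k : ℝ) + 1 ≠ 0 := by positivity
  simp only [Rcoeff, poch_succ, Nat.factorial_succ]
  push_cast
  field_simp
  ring

/-- Partial sums of `R_n` satisfy the eigenvalue equation up to a multiple of the last term. -/
theorem difference_operator_partial_sum {α₁ α₂ : ℝ} (h₁ : ∀ m : ℕ, α₁ + 1 + m ≠ 0)
    (h₂ : ∀ m : ℕ, α₂ + 1 + m ≠ 0) (α₃ : ℝ) (n : ℕ) (x : ℝ) (N : ℕ) :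
    let S : ℝ → ℝ := fun y => ∑ k ∈ Finset.range (N + 1), Rcoeff α₁ α₂ α₃ n k * poch (-y) k;
    -x * (x + α₃) * (S (x + 1) - 2 * S x + S (x - 1))
      + ((α₃ - α₁ - α₂ - 2) * x - (1 + α₁) * (1 + α₂)) * (S (x + 1) - S x)
      = n * (α₃ - α₁ - α₂ - 1 - n) * S x
        - (n * (α₃ - α₁ - α₂ - 1 - n) - N * (α₃ - α₁ - α₂ - 1 - N))
          * (Rcoeff α₁ α₂ α₃ n N * poch (-x) N) := by
  induction N with
  | zero =>
    simp only [zero_add, Finset.sum_range_one, poch, Finset.prod_range_zero]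
    push_cast
    ring
  | succ N ih =>
    simp only [Finset.sum_range_succ _ (N + 1)] at ih ⊢
    push_cast
    linear_combination ih + Rcoeff α₁ α₂ α₃ n (N + 1) * difference_operator_poch α₁ α₂ α₃ x N
      + poch (-x) N * Rcoeff_succ h₁ h₂ α₃ n N

/-- Proposition 4.1: `R_n` is an eigenfunction of the difference operator
`D = −x(x+α₃)∇Δ + ((α₃−α₁−α₂−2)x − (1+α₁)(1+α₂))Δ`
with eigenvalue `n(α₃−α₁−α₂−1−n)`. -/
theorem Rpol_difference_equation (α₁ α₂ α₃ : ℝ)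
    (h₁ : ∀ m : ℤ, m < 0 → α₁ ≠ (m : ℝ))
    (h₂ : ∀ m : ℤ, m < 0 → α₂ ≠ (m : ℝ))
    (n : ℕ) (x : ℝ) :
    -x * (x + α₃) * (Rpol α₁ α₂ α₃ n (x + 1) - 2 * Rpol α₁ α₂ α₃ n x
        + Rpol α₁ α₂ α₃ n (x - 1))
      + ((α₃ - α₁ - α₂ - 2) * x - (1 + α₁) * (1 + α₂))
          * (Rpol α₁ α₂ α₃ n (x + 1) - Rpol α₁ α₂ α₃ n x)
      = (n : ℝ) * (α₃ - α₁ - α₂ - 1 - (n : ℝ)) * Rpol α₁ α₂ α₃ n x := by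
  have shift_ne_zero : ∀ α : ℝ, (∀ m : ℤ, m < 0 → α ≠ (m : ℝ)) → ∀ m : ℕ, α + 1 + m ≠ 0 := by
    intro α h m hm
    refine h (-(m + 1)) (by lia) ?_
    push_cast
    linarith
  simp only [Rpol_eq_sum_Rcoeff]
  simpa using difference_operator_partial_sum (shift_ne_zero α₁ h₁) (shift_ne_zero α₂ h₂) α₃ n x n
end

section
/- Let d ≥ 2 and let b, l_{i,j}, s_i ∈ ℝ (1 ≤ i,j ≤ d). Define α_{i,j}(x) = x_j(x_i − l_{i,j}) for i ≠ j, β_i(x) = −x_i Σ_{k=1}^d x_k + Σ_{k=1}^d l_{i,k} x_k + b x_i + s_i, and γ_i(x) = x_i(−Σ_{k=1}^d x_k + Σ_{k=1}^d l_{k,i}). Then the compatibility conditions — α_{i,j}(x−e_i) β_j(x−e_j) γ_i(x) = α_{j,i}(x−e_j) β_i(x−e_i) γ_j(x) and β_i(x−e_i) β_j(x−e_i−e_j) γ_j(x) γ_i(x−e_j) = β_j(x−e_j) β_i(x−e_i−e_j) γ_i(x) γ_j(x−e_i) — hold for all x ∈ ℝ^d and all 1 ≤ i ≠ j ≤ d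 if and only if there exist real numbers l_1, …, l_d such that l_{i,j} = l_i for all j ≠ i, and either (Solution 1) there exists r ∈ ℝ with l_{i,i} = l_i + r and s_i = −l_i(b + r) for all i, or (Solution 2) b = Σ_{k=1}^d l_k − 1 and there exist r_1, …, r_d ∈ ℝ with l_{i,i} = l_i + r_i and s_i = −l_i(b + r_i) for all i. -/
open Finset

theorem sum_er (d : ℕ) (i : Fin d) : ∑ k, er d i k = 1 := by
  simp [er]

theorem sum_mul_er (d : ℕ) (f : Fin d → ℝ) (i : Fin d) : ∑ k, f k * er d i k = f i := by
  simp [er]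

theorem er_self (d : ℕ) (i : Fin d) : er d i i = 1 := by
  simp [er]

theorem er_of_ne {d : ℕ} {i j : Fin d} (h : j ≠ i) : er d i j = 0 := by
  simp [er, h]

/-- A continuous function killed by a product of two monic linear factors vanishes at `0`. -/
theorem eq_zero_of_linear_mul_linear_mul {g : ℝ → ℝ} (hg : Continuous g) (p q : ℝ)
    (h : ∀ t, (t + p) * (t + q) * g t = 0) : g 0 = 0 := by
  have hd : Dense (({-p, -q} : Set ℝ)ᶜ) := (Set.toFinite _).countable.dense_compl ℝ
  refine congrFun (hg.ext_on hd continuous_const (g := fun _ => (0 : ℝ)) fun t ht => ?_) 0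
  simp only [Set.mem_compl_iff, Set.mem_insert_iff, Set.mem_singleton_iff, not_or] at ht
  have hp : t + p ≠ 0 := fun h0 => ht.1 (by linarith)
  have hq : t + q ≠ 0 := fun h0 => ht.2 (by linarith)
  exact (mul_eq_zero.mp (h t)).resolve_left (mul_ne_zero hp hq)

/-- The first compatibility condition forces `β i (x - e_i)` to vanish on the hyperplane
`x i = 1 + l i j`. -/
theorem beta_shift_eq_zero_of_compat {d : ℕ} {b : ℝ} {l : Fin d → Fin d → ℝ} {s : Fin d → ℝ}
    {β : Fin d → (Fin d → ℝ) → ℝ}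
    (hβ : ∀ i, ∀ x : Fin d → ℝ,
        β i x = -(x i) * (∑ k, x k) + (∑ k, l i k * x k) + b * x i + s i)
    {i j : Fin d} (hij : i ≠ j) (c c' : ℝ)
    (H : ∀ x : Fin d → ℝ,
        x j * (x i - 1 - l i j) * β j (x - er d j) * (x i * (-(∑ k, x k) + c))
          = x i * (x j - 1 - l j i) * β i (x - er d i) * (x j * (-(∑ k, x k) + c')))
    {x : Fin d → ℝ} (hx : x i = 1 + l i j) : β i (x - er d i) = 0 := by
  have hcβ : ∀ i, Continuous (β i) := fun i => by
    rw [funext (hβ i)]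
    fun_prop
  have cancel : ∀ y : Fin d → ℝ,
      (y i - 1 - l i j) * β j (y - er d j) * (-(∑ k, y k) + c)
        - (y j - 1 - l j i) * β i (y - er d i) * (-(∑ k, y k) + c') = 0 := fun y => by
    have hcont : Continuous fun t : ℝ =>
        (fun z : Fin d → ℝ => (z i - 1 - l i j) * β j (z - er d j) * (-(∑ k, z k) + c)
          - (z j - 1 - l j i) * β i (z - er d i) * (-(∑ k, z k) + c'))
          (y + t • (er d i + er d j)) := by
      have := hcβ i
      have := hcβ j
      fun_prop
    have h0 := eq_zero_of_linear_mul_linear_mul hcont (y i) (y j) fun t => by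
      have h := H (y + t • (er d i + er d j))
      have hi : (y + t • (er d i + er d j)) i = t + y i := by
        simp [er_self, er_of_ne hij, add_comm]
      have hj : (y + t • (er d i + er d j)) j = t + y j := by
        simp [er_self, er_of_ne hij.symm, add_comm]
      simp only [hi, hj] at h ⊢
      linear_combination h
    simpa using h0
  have hcont : Continuous fun t : ℝ => β i (x + t • er d j - er d i) := by
    have := hcβ i
    fun_prop
  have h0 := eq_zero_of_linear_mul_linear_mul hcont (x j - 1 - l j i) ((∑ k, x k) - c')
    fun t => by
      have h := cancel (x + t • er d j)
      have hi : (x + t • er d j) i = 1 + l i j := by simp [er_of_ne hij, hx]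
      have hj : (x + t • er d j) j = t + x j := by simp [er_self, add_comm]
      have hs : ∑ k, (x + t • er d j) k = t + ∑ k, x k := by
        simp [sum_add_distrib, ← mul_sum, sum_er, add_comm]
      rw [hi, hj, hs] at h
      linear_combination h
  simpa using h0

/-- Rows of `l` are constant off the diagonal, and `s` is determined, once `β i (x - e_i)`
vanishes on the hyperplanes `x i = 1 + l i j`. -/
theorem params_of_beta_shift_eq_zero {d : ℕ} {b : ℝ} {l : Fin d → Fin d → ℝ} {s : Fin d → ℝ}
    {β : Fin d → (Fin d → ℝ) → ℝ}
    (hβ : ∀ i, ∀ x : Fin d → ℝ,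
        β i x = -(x i) * (∑ k, x k) + (∑ k, l i k * x k) + b * x i + s i)
    {i j : Fin d}
    (H : ∀ x : Fin d → ℝ, x i = 1 + l i j → β i (x - er d i) = 0) :
    (∀ k, k ≠ i → l i k = l i j) ∧ s i = -(l i j) * (b + (l i i - l i j)) := by
  have h0 := H ((1 + l i j) • er d i) (by simp [er_self])
  rw [hβ] at h0
  simp only [Pi.sub_apply, Pi.smul_apply, smul_eq_mul, er_self, mul_sub, sum_sub_distrib,
    ← mul_sum, sum_er, mul_left_comm _ (1 + l i j), sum_mul_er] at h0
  refine ⟨fun k hk => ?_, by linear_combination h0⟩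
  have h1 := H ((1 + l i j) • er d i + er d k) (by simp [er_self, er_of_ne hk.symm])
  rw [hβ] at h1
  simp only [Pi.sub_apply, Pi.add_apply, Pi.smul_apply, smul_eq_mul, er_self, mul_sub, mul_add,
    sum_sub_distrib, sum_add_distrib, er_of_ne hk.symm,
    ← mul_sum, sum_er, mul_left_comm _ (1 + l i j), sum_mul_er] at h1
  linear_combination h1 - h0

theorem beta_eq_mul {d : ℕ} {b : ℝ} {l : Fin d → Fin d → ℝ} {s : Fin d → ℝ}
    {L r : Fin d → ℝ} (hl : ∀ i j, l i j = L i + r i * er d i j)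
    (hs : ∀ i, s i = -(L i) * (b + r i)) (i : Fin d) (x : Fin d → ℝ) :
    -(x i) * (∑ k, x k) + (∑ k, l i k * x k) + b * x i + s i
      = (x i - L i) * (b + r i - ∑ k, x k) := by
  have h : ∑ k, l i k * x k = L i * (∑ k, x k) + r i * x i := by
    simp only [hl, add_mul, sum_add_distrib, ← mul_sum, mul_assoc, mul_comm (er d i _),
      sum_mul_er]
  rw [h, hs]
  ring

theorem sum_column {d : ℕ} {l : Fin d → Fin d → ℝ} {L r : Fin d → ℝ}
    (hl : ∀ i j, l i j = L i + r i * er d i j) (i : Fin d) :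
    ∑ k, l k i = (∑ k, L k) + r i := by
  simp [hl, sum_add_distrib, er]

/-- Proposition 5.1: for `a = −1` the compatibility conditions (2.12) for the
coefficients (5.1) hold if and only if the parameters have the form of
Solution 1 or Solution 2. -/
theorem compat_solutions_quadratic (d : ℕ) (hd : 2 ≤ d) (b : ℝ)
    (l : Fin d → Fin d → ℝ) (s : Fin d → ℝ)
    (α : Fin d → Fin d → (Fin d → ℝ) → ℝ)
    (hα : ∀ i j, i ≠ j → ∀ x : Fin d → ℝ, α i j x = x j * (x i - l i j))
    (β : Fin d → (Fin d → ℝ) → ℝ)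
    (hβ : ∀ i, ∀ x : Fin d → ℝ,
        β i x = -(x i) * (∑ k, x k) + (∑ k, l i k * x k) + b * x i + s i)
    (γ : Fin d → (Fin d → ℝ) → ℝ)
    (hγ : ∀ i, ∀ x : Fin d → ℝ, γ i x = x i * (-(∑ k, x k) + ∑ k, l k i)) :
    ((∀ i j : Fin d, i ≠ j → ∀ x : Fin d → ℝ,
        α i j (x - er d i) * β j (x - er d j) * γ i x
          = α j i (x - er d j) * β i (x - er d i) * γ j x)
      ∧ (∀ i j : Fin d, i ≠ j → ∀ x : Fin d → ℝ,
        β i (x - er d i) * β j (x - er d i - er d j) * γ j x * γ i (x - er d j)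
          = β j (x - er d j) * β i (x - er d i - er d j) * γ i x * γ j (x - er d i)))
    ↔ (∃ L : Fin d → ℝ, (∀ i j : Fin d, j ≠ i → l i j = L i)
        ∧ ((∃ r : ℝ, ∀ i : Fin d, l i i = L i + r ∧ s i = -(L i) * (b + r))
          ∨ (b = (∑ k, L k) - 1
            ∧ ∃ r : Fin d → ℝ, ∀ i : Fin d,
                l i i = L i + r i ∧ s i = -(L i) * (b + r i)))) := by
  have hS : ∀ (x : Fin d → ℝ) (i : Fin d), ∑ k, (x - er d i) k = (∑ k, x k) - 1 := fun x i => by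
    simp [sum_sub_distrib, sum_er]
  constructor
  · rintro ⟨H, -⟩
    have : Nontrivial (Fin d) := Fin.nontrivial_iff_two_le.mpr hd
    choose f hf using fun i : Fin d => exists_ne i
    have key : ∀ i, (∀ k, k ≠ i → l i k = l i (f i)) ∧
        s i = -(l i (f i)) * (b + (l i i - l i (f i))) := fun i =>
      params_of_beta_shift_eq_zero hβ fun x hx =>
        beta_shift_eq_zero_of_compat hβ (hf i).symm (∑ k, l k i) (∑ k, l k (f i))
          (fun y => by
            have h := H i (f i) (hf i).symm y
            rw [hα _ _ (hf i).symm, hα _ _ (hf i), hγ, hγ] at h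
            simpa [er_self, er_of_ne (hf i), er_of_ne (hf i).symm] using h) hx
    set L : Fin d → ℝ := fun i => l i (f i) with hL
    set r : Fin d → ℝ := fun i => l i i - L i with hr
    have hl : ∀ i j, l i j = L i + r i * er d i j := fun i j => by
      by_cases hji : j = i
      · subst hji
        simp [er_self, hr]
      · rw [er_of_ne hji, (key i).1 j hji]
        ring
    have hs : ∀ i, s i = -(L i) * (b + r i) := fun i => (key i).2
    have hβ' := fun i x => (hβ i x).trans (beta_eq_mul hl hs i x)
    have hdiag : ∀ i, l i i = L i + r i := fun i => by simp [hr]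
    refine ⟨L, fun i j hji => (key i).1 j hji, ?_⟩
    by_cases hb : b = (∑ k, L k) - 1
    · exact Or.inr ⟨hb, r, fun i => ⟨hdiag i, hs i⟩⟩
    have hr_eq : ∀ i j, i ≠ j → r i = r j := fun i j hij => by
      set N : ℝ := 2 + |L i| + |L j| with hN
      have h := H i j hij (N • (er d i + er d j))
      have hi : (N • (er d i + er d j)) i = N := by simp [er_self, er_of_ne hij]
      have hj : (N • (er d i + er d j)) j = N := by simp [er_self, er_of_ne hij.symm]
      simp only [hα _ _ hij, hα _ _ hij.symm, hγ, hβ', sum_column hl, hS] at h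
      simp only [Pi.sub_apply, hi, hj, er_self, er_of_ne hij, er_of_ne hij.symm, sub_zero,
        (key i).1 j hij.symm, (key j).1 i hij] at h
      have hNi : N - 1 - L i ≠ 0 :=
        ne_of_gt (by linarith [le_abs_self (L i), abs_nonneg (L j)])
      have hNj : N - 1 - L j ≠ 0 :=
        ne_of_gt (by linarith [le_abs_self (L j), abs_nonneg (L i)])
      have hN0 : N ≠ 0 := by positivity
      have hprod : (N * N * (N - 1 - L i) * (N - 1 - L j) * (b - ((∑ k, L k) - 1)))
          * (r i - r j) = 0 := by
        linear_combination h
      exact sub_eq_zero.mp ((mul_eq_zero.mp hprod).resolve_left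
        (mul_ne_zero (by simp [hN0, hNi, hNj]) (sub_ne_zero.mpr hb)))
    refine Or.inl ⟨r ⟨0, by omega⟩, fun i => ?_⟩
    have hri : r i = r ⟨0, by omega⟩ := by
      by_cases hi : i = ⟨0, by omega⟩
      · rw [hi]
      · exact hr_eq _ _ hi
    rw [← hri]
    exact ⟨hdiag i, hs i⟩
  · rintro ⟨L, hL, hsol⟩
    obtain ⟨r, hr, hs, hbr⟩ : ∃ r : Fin d → ℝ, (∀ i, l i i = L i + r i) ∧
        (∀ i, s i = -(L i) * (b + r i)) ∧ (b = (∑ k, L k) - 1 ∨ ∀ i j, r i = r j) := by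
      rcases hsol with ⟨r, h⟩ | ⟨hb, r, h⟩
      · exact ⟨fun _ => r, fun i => (h i).1, fun i => (h i).2, Or.inr fun _ _ => rfl⟩
      · exact ⟨r, fun i => (h i).1, fun i => (h i).2, Or.inl hb⟩
    have hl : ∀ i j, l i j = L i + r i * er d i j := fun i j => by
      by_cases hji : j = i
      · rw [hji, er_self, hr, mul_one]
      · rw [er_of_ne hji, hL i j hji, mul_zero, add_zero]
    have hβ' := fun i x => (hβ i x).trans (beta_eq_mul hl hs i x)
    constructor <;> intro i j hij x <;>
      simp only [hα _ _ hij, hα _ _ hij.symm, hγ, hβ', sum_column hl, hS] <;>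
      simp only [Pi.sub_apply, er_self, er_of_ne hij, er_of_ne hij.symm, sub_zero,
        hL _ _ hij, hL _ _ hij.symm] <;>
      rcases hbr with hb | hrr
    · rw [hb]; ring
    · rw [hrr i j]; ring
    · rw [hb]; ring
    · rw [hrr i j]; ring
end
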